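/- Let σ : Σ → Σ be a transitive subshift of finite type, φ : Σ → ℚ a locally constant constraint which is not cohomologous to a constant, and A : Σ → ℝ a Walters potential. Then for each c ∈ ℝ and each ε > 0 there exist a rational number r in the interior of the rotation set φ_*(M_σ) and a periodic probability measure μ with φ_*(μ) = r satisfying c·r − ∫A dμ < α_{A,φ}(c) + ε. -/

import Mathlib

open MeasureTheory Filter Topology Set

/-- The left shift on the full shift space `{1,…,N}^ℕ`. -/
def Shift {N : ℕ} : (ℕ → Fin N) → (ℕ → Fin N) := fun x i => x (i + 1)

/-- `S` is a subshift of finite type: it is the set of sequences all of whose transitions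
are allowed by some transition relation `M`. -/
def IsSubshiftFT {N : ℕ} (S : Set (ℕ → Fin N)) : Prop :=
  ∃ M : Fin N → Fin N → Prop, S = {x | ∀ i, M (x i) (x (i + 1))}

/-- The Birkhoff sum `S_k f` for the shift. -/
def birkhoff {N : ℕ} {E : Type*} [AddCommMonoid E] (k : ℕ) (f : (ℕ → Fin N) → E)
    (x : ℕ → Fin N) : E :=
  ∑ j ∈ Finset.range k, f (Shift^[j] x)

open Classical in
/-- The metric `d(x,y) = λ^{min{j : x_j ≠ y_j}}` on the shift space. -/
noncomputable def sdist {N : ℕ} (lam : ℝ) (x y : ℕ → Fin N) : ℝ :=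
  if x = y then 0 else lam ^ sInf {j | x j ≠ y j}

/-- `f` is a Walters function on `S` (for the metric with parameter `λ`): there is
`H : ℝ₊ → ℝ₊ ∪ {+∞}` increasing, null and continuous at zero, such that `d_k(x,y) ≤ s`
implies `|S_k f(x) - S_k f(y)| ≤ H(s)`. -/
def IsWalters {N : ℕ} (S : Set (ℕ → Fin N)) (lam : ℝ) (f : (ℕ → Fin N) → ℝ) : Prop :=
  ∃ H : ℝ → ENNReal, Monotone H ∧ H 0 = 0 ∧ Tendsto H (nhdsWithin 0 (Ioi 0)) (nhds 0) ∧
    ∀ s : ℝ, 0 ≤ s → ∀ k : ℕ, 0 < k → ∀ x ∈ S, ∀ y ∈ S,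
      (∀ j < k, sdist lam (Shift^[j] x) (Shift^[j] y) ≤ s) →
      ENNReal.ofReal |birkhoff k f x - birkhoff k f y| ≤ H s

/-- A function on the shift space is locally constant if it depends on finitely many
coordinates. -/
def LocallyConstantFn {N : ℕ} {E : Type*} (f : (ℕ → Fin N) → E) : Prop :=
  ∃ j : ℕ, ∀ x y : ℕ → Fin N, (∀ i ≤ j, x i = y i) → f x = f y

/-- The set `M_σ` of shift-invariant Borel probability measures giving full mass to the
subshift `S`. -/
def MS {N : ℕ} (S : Set (ℕ → Fin N)) : Set (ProbabilityMeasure (ℕ → Fin N)) :=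
  {μ | (μ : Measure (ℕ → Fin N)).map Shift = (μ : Measure (ℕ → Fin N)) ∧
    (μ : Measure (ℕ → Fin N)) S = 1}

/-- `μ` is a periodic probability measure of the subshift `S`: the uniform probability
measure on the orbit of a periodic point of `S`. -/
def IsPeriodicMeasure {N : ℕ} (S : Set (ℕ → Fin N)) (μ : ProbabilityMeasure (ℕ → Fin N)) :
    Prop :=
  ∃ z ∈ S, ∃ M : ℕ, 0 < M ∧ Shift^[M] z = z ∧
    (μ : Measure (ℕ → Fin N)) =
      (M : ENNReal)⁻¹ • ∑ j ∈ Finset.range M, Measure.dirac (Shift^[j] z)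

/-- `f` is joint recurrent with respect to the measure `ν`: for every measurable `D`,
`ν(Ξ(D)) = ν(D)`, where `Ξ(D)` is the set of `z ∈ D` such that for every `ε > 0` there is
`L > 0` with `σ^L(z) ∈ D` and `‖S_L f(z) - L f_*(ν)‖ < ε`. -/
def JointRec {N n : ℕ} (f : (ℕ → Fin N) → EuclideanSpace ℝ (Fin n))
    (ν : Measure (ℕ → Fin N)) : Prop :=
  ∀ D : Set (ℕ → Fin N), MeasurableSet D →
    ν {z ∈ D | ∀ ε > 0, ∃ L : ℕ, 0 < L ∧ Shift^[L] z ∈ D ∧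
      ‖birkhoff L f z - (L : ℝ) • ∫ x, f x ∂ν‖ < ε} = ν D

/-- Topological transitivity of the subshift `S`, expressed on cylinder sets: any two finite
words of `S` can be connected inside `S` by iterating the shift. -/
def TransitiveSubshift {N : ℕ} (S : Set (ℕ → Fin N)) : Prop :=
  ∀ x ∈ S, ∀ y ∈ S, ∀ m : ℕ, ∃ z ∈ S, ∃ k : ℕ,
    (∀ i < m, z i = x i) ∧ (∀ i < m, Shift^[k] z i = y i)

/-- The rotation set of a real constraint `φ` on the subshift `S`. -/
noncomputable def rotSet1 {N : ℕ} (S : Set (ℕ → Fin N)) (φ : (ℕ → Fin N) → ℝ) : Set ℝ :=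
  {h : ℝ | ∃ μ ∈ MS S, ∫ x, φ x ∂(μ : Measure (ℕ → Fin N)) = h}

/-- The beta function of the subshift `S` for a real constraint. -/
noncomputable def betaS1 {N : ℕ} (S : Set (ℕ → Fin N)) (A φ : (ℕ → Fin N) → ℝ)
    (r : ℝ) : ℝ :=
  sSup {t : ℝ | ∃ μ ∈ MS S, ∫ x, φ x ∂(μ : Measure (ℕ → Fin N)) = r ∧
    ∫ x, A x ∂(μ : Measure (ℕ → Fin N)) = t}

/-- The alpha function of the subshift `S` for a real constraint:
`α_{A,φ}(c) = min_{h ∈ φ_*(M_σ)} (c·h - β_{A,φ}(h))`. -/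
noncomputable def alphaS1 {N : ℕ} (S : Set (ℕ → Fin N)) (A φ : (ℕ → Fin N) → ℝ)
    (c : ℝ) : ℝ :=
  sInf ((fun h => c * h - betaS1 S A φ h) '' rotSet1 S φ)

/-- `g` is cohomologous to a constant on the subshift `S`: `g - a` is a topological cobord
`f ∘ σ - f` for some continuous `f` and some constant `a`. -/
def CohomologousToConstant {N : ℕ} (S : Set (ℕ → Fin N)) (g : (ℕ → Fin N) → ℝ) : Prop :=
  ∃ f : (ℕ → Fin N) → ℝ, Continuous f ∧ ∃ a : ℝ, ∀ x ∈ S, g x = f (Shift x) - f x + a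

section ShiftSpace

variable {N : ℕ} {S : Set (ℕ → Fin N)}

lemma shift_iterate_apply (j : ℕ) (x : ℕ → Fin N) (i : ℕ) : Shift^[j] x i = x (i + j) := by
  induction j generalizing x with
  | zero => rfl
  | succ j ih =>
    rw [Function.iterate_succ_apply, ih]
    simp only [Shift]
    congr 1

lemma measurable_shift : Measurable (Shift : (ℕ → Fin N) → (ℕ → Fin N)) :=
  measurable_pi_lambda _ fun i => measurable_pi_apply (i + 1)

lemma IsSubshiftFT.iterate_mem (hS : IsSubshiftFT S) {x : ℕ → Fin N} (hx : x ∈ S) (j : ℕ) :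
    Shift^[j] x ∈ S := by
  obtain ⟨M, rfl⟩ := hS
  intro i
  rw [shift_iterate_apply, shift_iterate_apply, add_right_comm]
  exact hx _

lemma IsSubshiftFT.measurableSet (hS : IsSubshiftFT S) : MeasurableSet S := by
  obtain ⟨M, rfl⟩ := hS
  rw [Set.ofPred_forall]
  refine MeasurableSet.iInter fun i => ?_
  have hpair : Measurable fun x : ℕ → Fin N => (x i, x (i + 1)) :=
    (measurable_pi_apply i).prodMk (measurable_pi_apply (i + 1))
  exact hpair (MeasurableSet.of_discrete (s := {p : Fin N × Fin N | M p.1 p.2}))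

/-- Two points of a subshift of finite type can be spliced at a common symbol. -/
lemma IsSubshiftFT.exists_splice (hS : IsSubshiftFT S) {x y : ℕ → Fin N} (hx : x ∈ S)
    (hy : y ∈ S) {n : ℕ} (h : x n = y 0) :
    ∃ z ∈ S, (∀ i ≤ n, z i = x i) ∧ Shift^[n] z = y := by
  obtain ⟨M, rfl⟩ := hS
  refine ⟨fun i => if i < n then x i else y (i - n), fun i => ?_, fun i hi => ?_, ?_⟩
  · rcases lt_trichotomy (i + 1) n with h1 | h1 | h1
    · simpa [h1, show i < n by omega] using hx i
    · have := hx i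
      rw [h1, h] at this
      simpa [h1, show i < n by omega] using this
    · have := hy (i - n)
      simpa [show ¬ i < n by omega, show ¬ i + 1 < n by omega,
        show i + 1 - n = i - n + 1 by omega] using this
  · rcases hi.lt_or_eq with h1 | rfl
    · simp [h1]
    · simp [h]
  · ext i
    rw [shift_iterate_apply]
    simp

/-- A word of a subshift of finite type which returns to its first symbol is shadowed by a
periodic point. -/
lemma IsSubshiftFT.exists_periodic (hS : IsSubshiftFT S) {x : ℕ → Fin N} (hx : x ∈ S) {p : ℕ}
    (hp : 0 < p) (h : x p = x 0) :
    ∃ z ∈ S, Shift^[p] z = z ∧ ∀ i ≤ p, z i = x i := by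
  obtain ⟨M, rfl⟩ := hS
  refine ⟨fun i => x (i % p), fun i => ?_, ?_, fun i hi => ?_⟩
  · have h1 := Nat.mod_lt i hp
    have h2 := hx (i % p)
    rcases (show i % p + 1 ≤ p from h1).lt_or_eq with h3 | h3
    · have : (i + 1) % p = i % p + 1 := by
        rw [← Nat.mod_add_mod, Nat.mod_eq_of_lt h3]
      simpa [this] using h2
    · have : (i + 1) % p = 0 := by
        rw [← Nat.mod_add_mod, h3, Nat.mod_self]
      rw [h3, h] at h2
      simpa [this] using h2
  · ext i
    rw [shift_iterate_apply]
    simp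
  · rcases hi.lt_or_eq with h1 | rfl
    · simp [Nat.mod_eq_of_lt h1]
    · simp [h]

/-- In a transitive subshift, any two symbols are joined by a word of uniformly bounded
length. -/
lemma TransitiveSubshift.exists_connect (ht : TransitiveSubshift S) :
    ∃ L : ℕ, ∀ x ∈ S, ∀ y ∈ S, ∃ l ≤ L, ∃ z ∈ S, z 0 = x 0 ∧ z l = y 0 := by
  have key : ∀ ab : Fin N × Fin N, ∃ l : ℕ, ∀ x ∈ S, ∀ y ∈ S, x 0 = ab.1 → y 0 = ab.2 →
      ∃ z ∈ S, z 0 = x 0 ∧ z l = y 0 := by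
    rintro ⟨a, b⟩
    by_cases h : ∃ x ∈ S, ∃ y ∈ S, x 0 = a ∧ y 0 = b
    · obtain ⟨x, hx, y, hy, rfl, rfl⟩ := h
      obtain ⟨z, hz, k, h1, h2⟩ := ht x hx y hy 1
      refine ⟨k, fun x' _ y' _ hx' hy' => ⟨z, hz, ?_, ?_⟩⟩
      · rw [hx', h1 0 one_pos]
      · have := h2 0 one_pos
        rw [shift_iterate_apply, zero_add] at this
        rw [hy', this]
    · exact ⟨0, fun x hx y hy h1 h2 => absurd ⟨x, hx, y, hy, h1, h2⟩ h⟩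
  choose l hl using key
  refine ⟨Finset.univ.sup l, fun x hx y hy => ⟨l (x 0, y 0), ?_, hl (x 0, y 0) x hx y hy rfl rfl⟩⟩
  exact Finset.le_sup (Finset.mem_univ _)

/-- Specification: words of two points can be concatenated with a uniformly bounded gap. -/
lemma IsSubshiftFT.exists_concat (hS : IsSubshiftFT S) (ht : TransitiveSubshift S) :
    ∃ L : ℕ, ∀ x ∈ S, ∀ y ∈ S, ∀ n : ℕ, ∃ l ≤ L, ∃ z ∈ S,
      (∀ i ≤ n, z i = x i) ∧ Shift^[n + l] z = y := by
  obtain ⟨L, hL⟩ := ht.exists_connect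
  refine ⟨L, fun x hx y hy n => ?_⟩
  obtain ⟨l, hl, v, hv, hv0, hvl⟩ := hL _ (hS.iterate_mem hx n) y hy
  obtain ⟨v', hv', h1, h2⟩ := hS.exists_splice hv hy hvl
  have h3 : x n = v' 0 := by
    rw [h1 0 (Nat.zero_le _), hv0, shift_iterate_apply, zero_add]
  obtain ⟨z, hz, h4, h5⟩ := hS.exists_splice hx hv' h3
  refine ⟨l, hl, z, hz, h4, ?_⟩
  rw [add_comm, Function.iterate_add_apply, h5, h2]

/-- Words of two points are shadowed, with uniformly bounded gaps, by one period of a periodic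
point. -/
lemma IsSubshiftFT.exists_periodic_concat (hS : IsSubshiftFT S) (ht : TransitiveSubshift S) :
    ∃ L : ℕ, ∀ z ∈ S, ∀ w ∈ S, ∀ a b : ℕ, 0 < a → ∃ u ∈ S, ∃ l l' : ℕ, l ≤ L ∧ l' ≤ L ∧
      Shift^[a + l + b + l'] u = u ∧ (∀ i < a, u i = z i) ∧
      ∀ i < b, Shift^[a + l] u i = w i := by
  obtain ⟨L, hL⟩ := hS.exists_concat ht
  refine ⟨L, fun z hz w hw a b ha => ?_⟩
  obtain ⟨l, hl, v, hv, h1, h2⟩ := hL z hz w hw a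
  obtain ⟨l', hl', v', hv', h3, h4⟩ := hL v hv z hz (a + l + b)
  have h5 : v' (a + l + b + l') = v' 0 := by
    rw [h3 0 (Nat.zero_le _), h1 0 (Nat.zero_le _), ← h4, shift_iterate_apply, zero_add]
  obtain ⟨u, hu, h6, h7⟩ := hS.exists_periodic hv' (by omega) h5
  refine ⟨u, hu, l, l', hl, hl', h6, fun i hi => ?_, fun i hi => ?_⟩
  · rw [h7 i (by omega), h3 i (by omega), h1 i (by omega)]
  · rw [shift_iterate_apply, h7 _ (by omega), h3 _ (by omega), ← h2, shift_iterate_apply]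

lemma birkhoff_add (m n : ℕ) (f : (ℕ → Fin N) → ℝ) (x : ℕ → Fin N) :
    birkhoff (m + n) f x = birkhoff m f x + birkhoff n f (Shift^[m] x) := by
  simp only [birkhoff, Finset.sum_range_add, ← Function.iterate_add_apply, add_comm]

lemma birkhoff_mul (k p : ℕ) (f : (ℕ → Fin N) → ℝ) {x : ℕ → Fin N} (hx : Shift^[p] x = x) :
    birkhoff (k * p) f x = k * birkhoff p f x := by
  induction k with
  | zero => simp [birkhoff]
  | succ k ih =>
    have h : Shift^[k * p] x = x := by
      rw [mul_comm, Function.iterate_mul]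
      exact Function.iterate_fixed hx k
    rw [add_mul, one_mul, birkhoff_add, h, ih]
    push_cast
    ring

lemma abs_birkhoff_le (hS : IsSubshiftFT S) {f : (ℕ → Fin N) → ℝ} {C : ℝ}
    (hC : ∀ x ∈ S, |f x| ≤ C) (n : ℕ) {x : ℕ → Fin N} (hx : x ∈ S) :
    |birkhoff n f x| ≤ n * C := by
  refine (Finset.abs_sum_le_sum_abs _ _).trans ?_
  refine (Finset.sum_le_card_nsmul _ _ C fun j _ => hC _ (hS.iterate_mem hx j)).trans ?_
  simp

/-- Uniform continuity on `S`, expressed on cylinders. -/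
def CylinderUC (S : Set (ℕ → Fin N)) (f : (ℕ → Fin N) → ℝ) : Prop :=
  ∀ δ > 0, ∃ m : ℕ, ∀ x ∈ S, ∀ y ∈ S, (∀ i < m, x i = y i) → |f x - f y| ≤ δ

lemma LocallyConstantFn.cylinderUC {f : (ℕ → Fin N) → ℝ} (hf : LocallyConstantFn f) :
    CylinderUC S f := by
  obtain ⟨j, hj⟩ := hf
  refine fun δ hδ => ⟨j + 1, fun x _ y _ h => ?_⟩
  rw [hj x y fun i hi => h i (by omega)]
  simpa using hδ.le

lemma sdist_le_of_agree {lam : ℝ} (h0 : 0 < lam) (h1 : lam < 1) {x y : ℕ → Fin N} {m : ℕ}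
    (h : ∀ i < m, x i = y i) : sdist lam x y ≤ lam ^ m := by
  unfold sdist
  split_ifs with hxy
  · positivity
  · refine pow_le_pow_of_le_one h0.le h1.le (le_csInf ?_ fun j hj => ?_)
    · exact Function.ne_iff.1 hxy
    · by_contra! hlt
      exact hj (h j hlt)

lemma IsWalters.cylinderUC {lam : ℝ} (h0 : 0 < lam) (h1 : lam < 1) {f : (ℕ → Fin N) → ℝ}
    (hf : IsWalters S lam f) : CylinderUC S f := by
  obtain ⟨H, -, -, hH, hf⟩ := hf
  intro δ hδ
  have hlim : Tendsto (fun m : ℕ => lam ^ m) atTop (𝓝[>] 0) :=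
    tendsto_nhdsWithin_iff.2 ⟨tendsto_pow_atTop_nhds_zero_of_lt_one h0.le h1,
      Eventually.of_forall fun m => pow_pos h0 m⟩
  obtain ⟨m, hm⟩ := ((hH.comp hlim).eventually_lt_const (ENNReal.ofReal_pos.2 hδ)).exists
  refine ⟨m, fun x hx y hy hxy => ?_⟩
  have h2 := hf (lam ^ m) (by positivity) 1 one_pos x hx y hy (by
    intro j hj
    obtain rfl : j = 0 := by omega
    exact sdist_le_of_agree h0 h1 hxy)
  have h3 := (ENNReal.ofReal_le_ofReal_iff hδ.le).1 (h2.trans hm.le)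
  simpa [birkhoff] using h3

namespace CylinderUC

lemma sub_const_mul {f g : (ℕ → Fin N) → ℝ} (hf : CylinderUC S f) (hg : CylinderUC S g)
    (c : ℝ) : CylinderUC S (fun x => f x - c * g x) := by
  intro δ hδ
  obtain ⟨m, hm⟩ := hf (δ / 2) (by positivity)
  obtain ⟨m', hm'⟩ := hg (δ / 2 / (|c| + 1)) (by positivity)
  refine ⟨max m m', fun x hx y hy h => ?_⟩
  have h1 := hm x hx y hy fun i hi => h i (lt_max_of_lt_left hi)
  have h2 := hm' x hx y hy fun i hi => h i (lt_max_of_lt_right hi)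
  rw [le_div_iff₀ (by positivity)] at h2
  have h3 : |c * (g x - g y)| ≤ δ / 2 := by
    rw [abs_mul]
    nlinarith [abs_nonneg (g x - g y)]
  calc |f x - c * g x - (f y - c * g y)| = |(f x - f y) - c * (g x - g y)| := by ring_nf
    _ ≤ |f x - f y| + |c * (g x - g y)| := abs_sub _ _
    _ ≤ δ := by linarith

lemma exists_bound {f : (ℕ → Fin N) → ℝ} (hf : CylinderUC S f) :
    ∃ C : ℝ, 0 ≤ C ∧ ∀ x ∈ S, |f x| ≤ C := by
  obtain ⟨m, hm⟩ := hf 1 one_pos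
  have key : ∀ w : Fin m → Fin N, ∃ C : ℝ, ∀ x ∈ S, (∀ i : Fin m, x i = w i) → |f x| ≤ C := by
    intro w
    by_cases h : ∃ y ∈ S, ∀ i : Fin m, y i = w i
    · obtain ⟨y, hy, hyw⟩ := h
      refine ⟨|f y| + 1, fun x hx hxw => ?_⟩
      have := hm x hx y hy fun i hi => (hxw ⟨i, hi⟩).trans (hyw ⟨i, hi⟩).symm
      have := abs_sub_abs_le_abs_sub (f x) (f y)
      linarith
    · exact ⟨0, fun x hx hxw => absurd ⟨x, hx, hxw⟩ h⟩
  choose C hC using key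
  obtain ⟨B, hB⟩ := (Set.finite_range C).bddAbove
  refine ⟨max B 0, le_max_right _ _, fun x hx => ?_⟩
  exact (hC (fun i => x i) x hx fun _ => rfl).trans
    ((hB (mem_range_self _)).trans (le_max_left _ _))

/-- Birkhoff sums along agreeing words differ by at most a sublinear error. -/
lemma abs_birkhoff_sub_le (hS : IsSubshiftFT S) {f : (ℕ → Fin N) → ℝ} (hf : CylinderUC S f)
    {δ : ℝ} (hδ : 0 < δ) :
    ∃ K : ℝ, 0 ≤ K ∧ ∀ x ∈ S, ∀ y ∈ S, ∀ n : ℕ, (∀ i < n, x i = y i) →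
      |birkhoff n f x - birkhoff n f y| ≤ n * δ + K := by
  obtain ⟨m, hm⟩ := hf δ hδ
  obtain ⟨C, hC0, hC⟩ := hf.exists_bound
  refine ⟨m * (2 * C), by positivity, fun x hx y hy n h => ?_⟩
  have hpre : ∀ k : ℕ, k + m ≤ n → |birkhoff k f x - birkhoff k f y| ≤ k * δ := by
    intro k hk
    rw [birkhoff, birkhoff, ← Finset.sum_sub_distrib]
    refine (Finset.abs_sum_le_sum_abs _ _).trans ?_
    refine (Finset.sum_le_card_nsmul _ _ δ fun j hj => ?_).trans (by simp)
    rw [Finset.mem_range] at hj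
    refine hm _ (hS.iterate_mem hx j) _ (hS.iterate_mem hy j) fun i hi => ?_
    rw [shift_iterate_apply, shift_iterate_apply, h _ (by omega)]
  have hany : ∀ k : ℕ, ∀ x ∈ S, ∀ y ∈ S,
      |birkhoff k f x - birkhoff k f y| ≤ k * (2 * C) := by
    intro k x hx y hy
    have h1 := abs_birkhoff_le hS hC k hx
    have h2 := abs_birkhoff_le hS hC k hy
    have h3 := abs_sub (birkhoff k f x) (birkhoff k f y)
    linarith
  rcases le_total m n with hmn | hmn
  · obtain ⟨k, rfl⟩ := Nat.exists_eq_add_of_le' hmn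
    rw [birkhoff_add, birkhoff_add]
    have h1 := hpre k le_rfl
    have h2 := hany m _ (hS.iterate_mem hx k) _ (hS.iterate_mem hy k)
    have h3 := abs_add_le (birkhoff k f x - birkhoff k f y)
      (birkhoff m f (Shift^[k] x) - birkhoff m f (Shift^[k] y))
    rw [add_sub_add_comm]
    push_cast
    have h4 : 0 ≤ (m : ℝ) * δ := by positivity
    linarith
  · have h1 := hany n x hx y hy
    have h2 : (n : ℝ) * (2 * C) ≤ m * (2 * C) := by gcongr
    have h3 : 0 ≤ (n : ℝ) * δ := by positivity
    linarith

/-- The average over one period of a point shadowing two words is close to the average over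
these words. -/
lemma abs_average_sub_le (hS : IsSubshiftFT S) {f : (ℕ → Fin N) → ℝ} (hf : CylinderUC S f)
    {δ : ℝ} (hδ : 0 < δ) (L : ℕ) :
    ∃ R : ℝ, ∀ z ∈ S, ∀ w ∈ S, ∀ u ∈ S, ∀ a b l l' : ℕ, 0 < a → l ≤ L → l' ≤ L →
      (∀ i < a, u i = z i) → (∀ i < b, Shift^[a + l] u i = w i) → R ≤ a + b →
      |birkhoff (a + l + b + l') f u / (a + l + b + l' : ℕ) -
        (birkhoff a f z + birkhoff b f w) / (a + b)| ≤ δ := by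
  obtain ⟨C, hC0, hC⟩ := hf.exists_bound
  obtain ⟨K, hK0, hK⟩ := hf.abs_birkhoff_sub_le hS (half_pos hδ)
  refine ⟨(2 * K + 4 * L * C) / (δ / 2), fun z hz w hw u hu a b l l' ha hl hl' h1 h2 hR => ?_⟩
  rw [div_le_iff₀ (by positivity)] at hR
  have ha' : (0 : ℝ) < a := by exact_mod_cast ha
  have hlL : (l : ℝ) ≤ L := by exact_mod_cast hl
  have hlL' : (l' : ℝ) ≤ L := by exact_mod_cast hl'
  have e1 := hK u hu z hz a h1
  have e2 := hK _ (hS.iterate_mem hu (a + l)) w hw b h2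
  have e3 := abs_birkhoff_le hS hC l (hS.iterate_mem hu a)
  have e4 := abs_birkhoff_le hS hC l' (hS.iterate_mem hu (a + l + b))
  have e5 := abs_birkhoff_le hS hC a hz
  have e6 := abs_birkhoff_le hS hC b hw
  have hsum : birkhoff (a + l + b + l') f u = birkhoff a f u + birkhoff l f (Shift^[a] u) +
      birkhoff b f (Shift^[a + l] u) + birkhoff l' f (Shift^[a + l + b] u) := by
    rw [birkhoff_add, birkhoff_add, birkhoff_add]
  have hlC : (l : ℝ) * C ≤ L * C := by gcongr
  have hlC' : (l' : ℝ) * C ≤ L * C := by gcongr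
  set X := birkhoff (a + l + b + l') f u
  set Y := birkhoff a f z + birkhoff b f w with hY
  have hXY : |X - Y| ≤ (a + b) * (δ / 2) + 2 * K + 2 * L * C := by
    rw [abs_le] at *
    constructor <;> linarith
  have hYb : |Y| ≤ (a + b) * C := by
    rw [abs_le] at *
    constructor <;> linarith
  have hT : ((a + l + b + l' : ℕ) : ℝ) = (a + b) + (l + l') := by push_cast; ring
  rw [hT]
  set R : ℝ := a + b with hRdef
  have hRpos : 0 < R := by positivity
  set T : ℝ := R + (l + l') with hTdef
  have hRT : R ≤ T := le_add_of_nonneg_right (by positivity)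
  have hTpos : 0 < T := by linarith
  have hfrac : X / T - Y / R = ((X - Y) - Y / R * (l + l')) / T := by
    rw [hTdef]
    field_simp
    ring
  have hYR : |Y / R| ≤ C := by
    rw [abs_div, abs_of_pos hRpos, div_le_iff₀ hRpos]
    linarith
  have hll : |Y / R * (l + l')| ≤ 2 * L * C := by
    rw [abs_mul, abs_of_nonneg (by positivity : (0 : ℝ) ≤ l + l')]
    calc |Y / R| * (l + l') ≤ C * (L + L) := by gcongr
      _ = 2 * L * C := by ring
  rw [hfrac, abs_div, abs_of_pos hTpos, div_le_iff₀ hTpos]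
  have h3 := abs_sub (X - Y) (Y / R * (l + l'))
  have h4 : δ * R ≤ δ * T := by gcongr
  linarith

end CylinderUC

section Livsic

/-- Birkhoff sums of a locally constant function only depend on a finite word. -/
lemma birkhoff_congr_of_agree {f : (ℕ → Fin N) → ℝ} {j : ℕ}
    (hj : ∀ x y : ℕ → Fin N, (∀ i ≤ j, x i = y i) → f x = f y) {n : ℕ} {x y : ℕ → Fin N}
    (h : ∀ i < n + j, x i = y i) : birkhoff n f x = birkhoff n f y := by
  refine Finset.sum_congr rfl fun k hk => hj _ _ fun i hi => ?_
  rw [Finset.mem_range] at hk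
  rw [shift_iterate_apply, shift_iterate_apply, h _ (by omega)]

lemma agree_splice {x y z : ℕ → Fin N} {n m : ℕ} (h1 : ∀ i ≤ n, z i = x i)
    (h2 : Shift^[n] z = y) (h : ∀ i < m, Shift^[n] x i = y i) (i : ℕ) (hi : i < n + m) :
    z i = x i := by
  rcases le_or_gt i n with hin | hin
  · exact h1 i hin
  · have := h (i - n) (by omega)
    rw [← h2, shift_iterate_apply, shift_iterate_apply, Nat.sub_add_cancel hin.le] at this
    exact this.symm

lemma birkhoff_eq_of_returning (hS : IsSubshiftFT S) {f : (ℕ → Fin N) → ℝ} {j : ℕ}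
    (hj : ∀ x y : ℕ → Fin N, (∀ i ≤ j, x i = y i) → f x = f y) {a : ℝ}
    (hper : ∀ z ∈ S, ∀ p : ℕ, 0 < p → Shift^[p] z = z → birkhoff p f z = p * a)
    {u : ℕ → Fin N} (hu : u ∈ S) {p : ℕ} (hret : ∀ i ≤ j, u (i + p) = u i) :
    birkhoff p f u = p * a := by
  rcases Nat.eq_zero_or_pos p with rfl | hp
  · simp [birkhoff]
  obtain ⟨z, hz, hzp, hzu⟩ := hS.exists_periodic hu hp (by simpa using hret 0 (Nat.zero_le _))
  rw [← hper z hz p hp hzp]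
  refine birkhoff_congr_of_agree hj fun i hi => ?_
  induction i using Nat.strong_induction_on with
  | _ i ih =>
    rcases le_or_gt i p with hip | hip
    · exact (hzu i hip).symm
    · have h1 := hret (i - p) (by omega)
      rw [Nat.sub_add_cancel hip.le] at h1
      have h2 : z i = z (i - p) := by
        conv_rhs => rw [← hzp, shift_iterate_apply, Nat.sub_add_cancel hip.le]
      rw [h1, h2]
      exact ih _ (by omega) (by omega)

/-- Livšic's theorem for locally constant functions. -/
lemma LocallyConstantFn.cohomologousToConstant (hS : IsSubshiftFT S)
    (ht : TransitiveSubshift S) {f : (ℕ → Fin N) → ℝ} (hf : LocallyConstantFn f) {a : ℝ}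
    (hper : ∀ z ∈ S, ∀ p : ℕ, 0 < p → Shift^[p] z = z → birkhoff p f z = p * a) :
    CohomologousToConstant S f := by
  classical
  obtain ⟨j, hj⟩ := hf
  rcases S.eq_empty_or_nonempty with rfl | ⟨y₀, hy₀⟩
  · exact ⟨0, continuous_const, 0, by simp⟩
  let P : (Fin (j + 1) → Fin N) → ℝ → Prop := fun w v => ∃ y ∈ S, ∃ n : ℕ,
    (∀ i < j + 1, y i = y₀ i) ∧ (∀ i : Fin (j + 1), Shift^[n] y i = w i) ∧
      v = birkhoff n f y - n * a
  let word : (ℕ → Fin N) → Fin (j + 1) → Fin N := fun x i => x i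
  have hex : ∀ x ∈ S, ∃ v, P (word x) v := by
    intro x hx
    obtain ⟨y, hy, n, h1, h2⟩ := ht y₀ hy₀ x hx (j + 1)
    exact ⟨_, y, hy, n, h1, fun i => h2 i i.2, rfl⟩
  have huniq : ∀ x ∈ S, ∃ v₀, ∀ v, P (word x) v → v = v₀ := by
    intro x hx
    obtain ⟨z, hz, k, hzx, hzk⟩ := ht x hx y₀ hy₀ (j + 1)
    refine ⟨k * a - birkhoff k f z, ?_⟩
    rintro v ⟨y, hy, n, h1, h2, rfl⟩
    have h2' : ∀ i < j + 1, Shift^[n] y i = z i := fun i hi =>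
      (h2 ⟨i, hi⟩).trans (hzx i hi).symm
    have hyz : y n = z 0 := by
      have := h2' 0 (Nat.succ_pos _)
      rwa [shift_iterate_apply, zero_add] at this
    obtain ⟨u, hu, hu1, hu2⟩ := hS.exists_splice hy hz hyz
    have hagree := agree_splice hu1 hu2 h2'
    have h3 : birkhoff (n + k) f u = (n + k : ℕ) * a := by
      refine birkhoff_eq_of_returning hS hj hper hu fun i hi => ?_
      have h4 := hzk i (by omega)
      rw [← hu2, ← Function.iterate_add_apply, shift_iterate_apply, add_comm k n] at h4
      rw [h4, hagree i (by omega), h1 i (by omega)]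
    rw [birkhoff_add, hu2,
      birkhoff_congr_of_agree hj fun i hi => hagree i (by omega)] at h3
    push_cast at h3
    linarith
  have hstep : ∀ x ∈ S, ∀ v, P (word x) v → P (word (Shift x)) (v + (f x - a)) := by
    rintro x hx v ⟨y, hy, n, h1, h2, rfl⟩
    have h2' : ∀ i < j + 1, Shift^[n] y i = x i := fun i hi => h2 ⟨i, hi⟩
    have hyx : y n = x 0 := by
      have := h2' 0 (Nat.succ_pos _)
      rwa [shift_iterate_apply, zero_add] at this
    obtain ⟨u, hu, hu1, hu2⟩ := hS.exists_splice hy hx hyx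
    have hagree := agree_splice hu1 hu2 h2'
    refine ⟨u, hu, n + 1, fun i hi => ?_, fun i => ?_, ?_⟩
    · rw [hagree i (by omega), h1 i hi]
    · rw [Function.iterate_succ_apply', hu2]
    · rw [birkhoff_add, hu2,
        birkhoff_congr_of_agree hj fun i hi => hagree i (by omega)]
      simp only [birkhoff, Finset.sum_range_one, Function.iterate_zero, id_eq]
      push_cast
      ring
  let g : (Fin (j + 1) → Fin N) → ℝ := fun w => if h : ∃ v, P w v then h.choose else 0
  have hg : ∀ x ∈ S, P (word x) (g (word x)) := by
    intro x hx
    simp only [g, dif_pos (hex x hx)]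
    exact (hex x hx).choose_spec
  refine ⟨fun x => g (word x), ?_, a, fun x hx => ?_⟩
  · have hw : Continuous word := continuous_pi fun i => continuous_apply (i : ℕ)
    exact (continuous_of_discreteTopology (f := g)).comp hw
  · have hx' : Shift x ∈ S := hS.iterate_mem hx 1
    obtain ⟨v₀, hv₀⟩ := huniq _ hx'
    have h1 := hv₀ _ (hg _ hx')
    have h2 := hv₀ _ (hstep x hx _ (hg x hx))
    linarith

end Livsic

section Measure

lemma ae_mem_of_mem_MS (hS : IsSubshiftFT S) {μ : ProbabilityMeasure (ℕ → Fin N)}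
    (hμ : μ ∈ MS S) : ∀ᵐ x ∂(μ : Measure (ℕ → Fin N)), x ∈ S :=
  (mem_ae_iff_prob_eq_one hS.measurableSet).2 hμ.2

lemma CylinderUC.integrable (hS : IsSubshiftFT S) {f : (ℕ → Fin N) → ℝ} (hf : CylinderUC S f)
    (hfm : Measurable f) {μ : ProbabilityMeasure (ℕ → Fin N)} (hμ : μ ∈ MS S) :
    Integrable f (μ : Measure (ℕ → Fin N)) := by
  obtain ⟨C, -, hC⟩ := hf.exists_bound
  refine Integrable.of_bound hfm.aestronglyMeasurable C ?_
  filter_upwards [ae_mem_of_mem_MS hS hμ] with x hx using hC x hx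

/-- The Birkhoff sums exceed their mean at some point of the subshift. -/
lemma exists_integral_le_birkhoff (hS : IsSubshiftFT S) {f : (ℕ → Fin N) → ℝ}
    (hfm : Measurable f) {μ : ProbabilityMeasure (ℕ → Fin N)} (hμ : μ ∈ MS S)
    (hfi : Integrable f (μ : Measure (ℕ → Fin N))) (n : ℕ) :
    ∃ x ∈ S, n * ∫ x, f x ∂(μ : Measure (ℕ → Fin N)) ≤ birkhoff n f x := by
  have hmp : MeasurePreserving Shift (μ : Measure (ℕ → Fin N)) (μ : Measure (ℕ → Fin N)) :=
    ⟨measurable_shift, hμ.1⟩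
  have hintegrable : ∀ j, Integrable (fun x => f (Shift^[j] x)) (μ : Measure (ℕ → Fin N)) := fun j =>
    (hmp.iterate j).integrable_comp_of_integrable hfi
  have heq : ∀ j, ∫ x, f (Shift^[j] x) ∂(μ : Measure (ℕ → Fin N)) =
      ∫ x, f x ∂(μ : Measure (ℕ → Fin N)) := by
    intro j
    conv_rhs => rw [← (hmp.iterate j).map_eq]
    exact (integral_map (hmp.iterate j).measurable.aemeasurable
      hfm.aestronglyMeasurable).symm
  have hbi : Integrable (birkhoff n f) (μ : Measure (ℕ → Fin N)) :=
    integrable_finsetSum _ fun j _ => hintegrable j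
  obtain ⟨x, hx, h⟩ := exists_notMem_null_integral_le hbi (ae_mem_of_mem_MS hS hμ)
  refine ⟨x, by simpa using hx, le_trans (le_of_eq ?_) h⟩
  simp only [birkhoff]
  rw [integral_finsetSum _ fun j _ => hintegrable j]
  simp [heq]

/-- A periodic point carries a periodic invariant measure. -/
lemma exists_periodicMeasure (hS : IsSubshiftFT S) {z : ℕ → Fin N} (hz : z ∈ S) {p : ℕ}
    (hp : 0 < p) (hzp : Shift^[p] z = z) :
    ∃ μ ∈ MS S, IsPeriodicMeasure S μ ∧
      ∀ f : (ℕ → Fin N) → ℝ, ∫ x, f x ∂(μ : Measure (ℕ → Fin N)) = birkhoff p f z / p := by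
  have hp0 : (p : ENNReal) ≠ 0 := by exact_mod_cast hp.ne'
  let ν : Measure (ℕ → Fin N) :=
    (p : ENNReal)⁻¹ • ∑ j ∈ Finset.range p, Measure.dirac (Shift^[j] z)
  have hone : ∀ s : Set (ℕ → Fin N), MeasurableSet s → (∀ j, Shift^[j] z ∈ s) → ν s = 1 := by
    intro s hs h
    simp only [ν, Measure.smul_apply, Measure.finsetSum_apply, Measure.dirac_apply' _ hs,
      indicator_of_mem (h _), Pi.one_apply, Finset.sum_const, Finset.card_range, smul_eq_mul,
      nsmul_eq_mul, mul_one]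
    exact ENNReal.inv_mul_cancel hp0 (ENNReal.natCast_ne_top p)
  have hprob : IsProbabilityMeasure ν := ⟨hone _ MeasurableSet.univ fun _ => mem_univ _⟩
  refine ⟨⟨ν, hprob⟩, ⟨?_, hone S hS.measurableSet (hS.iterate_mem hz)⟩,
    ⟨z, hz, p, hp, hzp, rfl⟩, fun f => ?_⟩
  · change Measure.map Shift ν = ν
    have hmap : ∀ k, Measure.map Shift (∑ j ∈ Finset.range k, Measure.dirac (Shift^[j] z)) =
        ∑ j ∈ Finset.range k, Measure.dirac (Shift^[j + 1] z) := by
      intro k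
      induction k with
      | zero => simp
      | succ k ih =>
        rw [Finset.sum_range_succ, Finset.sum_range_succ, Measure.map_add _ _ measurable_shift,
          ih, Measure.map_dirac' measurable_shift, Function.iterate_succ_apply']
    simp only [ν]
    rw [Measure.map_smul, hmap]
    congr 1
    obtain ⟨q, rfl⟩ := Nat.exists_eq_succ_of_ne_zero hp.ne'
    rw [Finset.sum_range_succ, hzp, Finset.sum_range_succ']
    rfl
  · change ∫ x, f x ∂ν = _
    simp only [ν]
    rw [integral_smul_measure, integral_finsetSum_measure fun j _ => integrable_dirac (by simp)]
    simp [birkhoff, div_eq_inv_mul]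

lemma rotSet1_ordConnected (hS : IsSubshiftFT S) {φ : (ℕ → Fin N) → ℝ} (hφ : CylinderUC S φ)
    (hφm : Measurable φ) : (rotSet1 S φ).OrdConnected := by
  refine Convex.ordConnected fun h₁ hh₁ h₂ hh₂ s t hs ht hst => ?_
  obtain ⟨μ, hμ, rfl⟩ := hh₁
  obtain ⟨ν, hν, rfl⟩ := hh₂
  lift s to NNReal using hs
  lift t to NNReal using ht
  have hst' : s + t = 1 := by exact_mod_cast hst
  have hst'' : (s : ENNReal) + t = 1 := by exact_mod_cast hst'
  let ρ : Measure (ℕ → Fin N) := (s : ENNReal) • (μ : Measure (ℕ → Fin N)) +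
    (t : ENNReal) • (ν : Measure (ℕ → Fin N))
  have hρ : ∀ A : Set (ℕ → Fin N), (μ : Measure (ℕ → Fin N)) A = 1 →
      (ν : Measure (ℕ → Fin N)) A = 1 → ρ A = 1 := by
    intro A h1 h2
    simp only [ρ, Measure.add_apply, Measure.smul_apply, h1, h2, smul_eq_mul, mul_one, hst'']
  have hprob : IsProbabilityMeasure ρ := ⟨hρ _ measure_univ measure_univ⟩
  refine ⟨⟨ρ, hprob⟩, ⟨?_, hρ S hμ.2 hν.2⟩, ?_⟩
  · change Measure.map Shift ρ = ρ
    simp only [ρ]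
    rw [Measure.map_add _ _ measurable_shift, Measure.map_smul, Measure.map_smul,
      hμ.1, hν.1]
  · change ∫ x, φ x ∂ρ = _
    simp only [ρ]
    rw [integral_add_measure ((hφ.integrable hS hφm hμ).smul_measure ENNReal.coe_ne_top)
      ((hφ.integrable hS hφm hν).smul_measure ENNReal.coe_ne_top), integral_smul_measure,
      integral_smul_measure]
    rfl

end Measure

/-- Periodic orbits approximate the supremum of the integrals of a continuous function. -/
lemma exists_periodic_integral_lt (hS : IsSubshiftFT S) (ht : TransitiveSubshift S)
    {f : (ℕ → Fin N) → ℝ} (hf : CylinderUC S f) (hfm : Measurable f)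
    {μ : ProbabilityMeasure (ℕ → Fin N)} (hμ : μ ∈ MS S) {δ : ℝ} (hδ : 0 < δ) :
    ∃ z ∈ S, ∃ p : ℕ, 0 < p ∧ Shift^[p] z = z ∧
      ∫ x, f x ∂(μ : Measure (ℕ → Fin N)) - δ ≤ birkhoff p f z / p := by
  obtain ⟨L, hL⟩ := hS.exists_periodic_concat ht
  obtain ⟨R, hR⟩ := hf.abs_average_sub_le hS hδ L
  obtain ⟨n, hn⟩ := exists_nat_ge R
  obtain ⟨x, hx, h⟩ := exists_integral_le_birkhoff hS hfm hμ (hf.integrable hS hfm hμ) (n + 1)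
  obtain ⟨u, hu, l, l', hl, hl', hper, h1, h2⟩ := hL x hx x hx (n + 1) 0 n.succ_pos
  refine ⟨u, hu, _, by omega, hper, ?_⟩
  have h3 := hR x hx x hx u hu (n + 1) 0 l l' n.succ_pos hl hl' h1 h2 (by push_cast; linarith)
  have h4 : ∫ x, f x ∂(μ : Measure (ℕ → Fin N)) ≤ (birkhoff (n + 1) f x + birkhoff 0 f x) /
      ((n + 1 : ℕ) + (0 : ℕ)) := by
    rw [le_div_iff₀ (by positivity)]
    simp only [birkhoff, Finset.sum_range_zero] at h ⊢
    push_cast at h ⊢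
    linarith
  linarith [(abs_le.1 h3).1]

/-- Two periodic orbits with distinct `φ`-averages can be mixed so that the `φ`-average is
strictly intermediate while the `f`-average stays close to the one of the first orbit. -/
lemma exists_periodic_between (hS : IsSubshiftFT S) (ht : TransitiveSubshift S)
    {φ f : (ℕ → Fin N) → ℝ} (hφ : CylinderUC S φ) (hf : CylinderUC S f)
    {z w : ℕ → Fin N} (hz : z ∈ S) (hw : w ∈ S) {p q : ℕ} (hp : 0 < p) (hq : 0 < q)
    (hzp : Shift^[p] z = z) (hwq : Shift^[q] w = w)
    (hne : birkhoff q φ w / q ≠ birkhoff p φ z / p) {δ : ℝ} (hδ : 0 < δ) :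
    ∃ u ∈ S, ∃ T : ℕ, 0 < T ∧ Shift^[T] u = u ∧
      birkhoff T φ u / T ∈ Ioo (min (birkhoff p φ z / p) (birkhoff q φ w / q))
        (max (birkhoff p φ z / p) (birkhoff q φ w / q)) ∧
      birkhoff p f z / p - δ ≤ birkhoff T f u / T := by
  obtain ⟨L, hL⟩ := hS.exists_periodic_concat ht
  have hp' : (0 : ℝ) < p := by exact_mod_cast hp
  have hq' : (0 : ℝ) < q := by exact_mod_cast hq
  obtain ⟨s, hs⟩ := exists_nat_ge
    (max 1 (|birkhoff q f w / q - birkhoff p f z / p| / (δ / 2)))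
  have hs1 : (1 : ℝ) ≤ s := (le_max_left _ _).trans hs
  have hs2 := (le_max_right _ _).trans hs
  rw [div_le_iff₀ (by positivity)] at hs2
  have hgap : 0 < |birkhoff q φ w / q - birkhoff p φ z / p| / (s + 1) / 2 :=
    half_pos (div_pos (abs_pos.2 (sub_ne_zero.2 hne)) (by positivity))
  obtain ⟨R₁, hR₁⟩ := hφ.abs_average_sub_le hS hgap L
  obtain ⟨R₂, hR₂⟩ := hf.abs_average_sub_le hS (half_pos hδ) L
  obtain ⟨n, hn⟩ := exists_nat_ge (max R₁ R₂)
  have hs0 : 0 < s := by exact_mod_cast (zero_lt_one.trans_le hs1)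
  have ha : 0 < s * (n + 1) * q * p := by positivity
  obtain ⟨u, hu, l, l', hl, hl', hper, h1, h2⟩ :=
    hL z hz w hw (s * (n + 1) * q * p) ((n + 1) * p * q) ha
  have hlarge : max R₁ R₂ ≤ (s * (n + 1) * q * p : ℕ) + ((n + 1) * p * q : ℕ) := by
    refine hn.trans ?_
    have : n ≤ (n + 1) * p * q := by
      calc n ≤ n + 1 := n.le_succ
        _ ≤ (n + 1) * p * q := by
          rw [mul_assoc]
          exact Nat.le_mul_of_pos_right _ (by positivity)
    exact_mod_cast this.trans (Nat.le_add_left _ _)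
  have havg : ∀ g : (ℕ → Fin N) → ℝ,
      (birkhoff (s * (n + 1) * q * p) g z + birkhoff ((n + 1) * p * q) g w) /
        ((s * (n + 1) * q * p : ℕ) + ((n + 1) * p * q : ℕ)) =
      birkhoff p g z / p + (birkhoff q g w / q - birkhoff p g z / p) / (s + 1) := by
    intro g
    rw [birkhoff_mul _ _ _ hzp, birkhoff_mul _ _ _ hwq]
    push_cast
    field_simp
    ring
  have e1 := hR₁ z hz w hw u hu _ _ l l' ha hl hl' h1 h2 ((le_max_left _ _).trans hlarge)
  have e2 := hR₂ z hz w hw u hu _ _ l l' ha hl hl' h1 h2 ((le_max_right _ _).trans hlarge)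
  rw [havg] at e1 e2
  refine ⟨u, hu, _, by omega, hper, ?_, ?_⟩
  · set X := birkhoff (s * (n + 1) * q * p + l + (n + 1) * p * q + l') φ u /
      (s * (n + 1) * q * p + l + (n + 1) * p * q + l' : ℕ)
    set x := birkhoff p φ z / p
    set y := birkhoff q φ w / q
    obtain ⟨e3, e4⟩ := abs_le.1 e1
    have hdiv : ∀ t : ℝ, 0 ≤ t → t / (s + 1) ≤ t / 2 := fun t ht0 => by gcongr; linarith
    rcases hne.lt_or_gt with hlt | hlt
    · rw [min_eq_right hlt.le, max_eq_left hlt.le]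
      rw [abs_of_neg (sub_neg.2 hlt)] at e3 e4 hgap
      have := hdiv (x - y) (by linarith)
      have h5 : (y - x) / ((s : ℝ) + 1) = -((x - y) / (s + 1)) := by ring
      have h6 : (-(y - x)) / ((s : ℝ) + 1) = (x - y) / (s + 1) := by ring
      rw [h6] at e3 e4 hgap
      rw [h5] at e3 e4
      constructor <;> linarith
    · rw [min_eq_left hlt.le, max_eq_right hlt.le]
      rw [abs_of_pos (sub_pos.2 hlt)] at e3 e4 hgap
      have := hdiv (y - x) (by linarith)
      constructor <;> linarith
  · have h3 : |(birkhoff q f w / q - birkhoff p f z / p) / (s + 1)| ≤ δ / 2 := by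
      rw [abs_div, abs_of_pos (by positivity : (0 : ℝ) < s + 1), div_le_iff₀ (by positivity)]
      linarith
    linarith [(abs_le.1 e2).1, (abs_le.1 h3).1]

end ShiftSpace

/-- on a transitive subshift of finite type, if `φ` is a rational-valued
locally constant constraint not cohomologous to a constant and `A` a Walters potential,
then for every `c ∈ ℝ` and `ε > 0` there are a rational `r` in the interior of the rotation
set and a periodic probability measure `μ` with `φ_*(μ) = r` and
`c·r - ∫A dμ < α_{A,φ}(c) + ε`. -/
theorem stmt17 {N : ℕ} (S : Set (ℕ → Fin N)) (hS : IsSubshiftFT S)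
    (htrans : TransitiveSubshift S)
    (lam : ℝ) (hlam0 : 0 < lam) (hlam1 : lam < 1)
    (φ : (ℕ → Fin N) → ℝ) (hφm : Measurable φ)
    (hφlc : LocallyConstantFn φ) (hφQ : ∀ x, ∃ q : ℚ, φ x = (q : ℝ))
    (hφnc : ¬ CohomologousToConstant S φ)
    (A : (ℕ → Fin N) → ℝ) (hAm : Measurable A) (hA : IsWalters S lam A)
    (c : ℝ) (ε : ℝ) (hε : 0 < ε) :
    ∃ r : ℝ, (∃ q : ℚ, r = (q : ℝ)) ∧ r ∈ interior (rotSet1 S φ) ∧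
      ∃ μ ∈ MS S, IsPeriodicMeasure S μ ∧
        ∫ x, φ x ∂(μ : Measure (ℕ → Fin N)) = r ∧
        c * r - ∫ x, A x ∂(μ : Measure (ℕ → Fin N)) < alphaS1 S A φ c + ε := by
  have hφu : CylinderUC S φ := hφlc.cylinderUC
  have hAu : CylinderUC S A := hA.cylinderUC hlam0 hlam1
  have hBu : CylinderUC S (fun x => A x - c * φ x) := hAu.sub_const_mul hφu c
  have hBm : Measurable (fun x => A x - c * φ x) := hAm.sub (hφm.const_mul c)
  have hBint : ∀ μ ∈ MS S, ∫ x, (A x - c * φ x) ∂(μ : Measure (ℕ → Fin N)) =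
      ∫ x, A x ∂(μ : Measure (ℕ → Fin N)) - c * ∫ x, φ x ∂(μ : Measure (ℕ → Fin N)) := by
    intro μ hμ
    rw [integral_sub (hAu.integrable hS hAm hμ) ((hφu.integrable hS hφm hμ).const_mul c),
      integral_const_mul]
  obtain ⟨x₀, hx₀⟩ : S.Nonempty := by
    by_contra hemp
    rw [Set.not_nonempty_iff_eq_empty] at hemp
    exact hφnc ⟨0, continuous_const, 0, by simp [hemp]⟩
  have hrot : (rotSet1 S φ).Nonempty := by
    obtain ⟨L, hL⟩ := hS.exists_periodic_concat htrans
    obtain ⟨u, hu, l, l', -, -, hper, -⟩ := hL x₀ hx₀ x₀ hx₀ 1 0 one_pos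
    obtain ⟨μ, hμ, -⟩ := exists_periodicMeasure hS hu (by omega) hper
    exact ⟨_, μ, hμ, rfl⟩
  obtain ⟨_, ⟨_, ⟨μ₀, hμ₀, rfl⟩, rfl⟩, hα⟩ := exists_lt_of_csInf_lt
    (hrot.image fun h => c * h - betaS1 S A φ h)
    (show alphaS1 S A φ c < alphaS1 S A φ c + ε / 4 by linarith)
  obtain ⟨_, ⟨μ, hμ, hμφ, rfl⟩, hβ⟩ := exists_lt_of_lt_csSup
    (s := {t : ℝ | ∃ μ ∈ MS S, ∫ x, φ x ∂(μ : Measure (ℕ → Fin N)) =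
      ∫ x, φ x ∂(μ₀ : Measure (ℕ → Fin N)) ∧ ∫ x, A x ∂(μ : Measure (ℕ → Fin N)) = t})
    ⟨_, μ₀, hμ₀, rfl, rfl⟩
    (show betaS1 S A φ (∫ x, φ x ∂(μ₀ : Measure (ℕ → Fin N))) - ε / 4 <
      betaS1 S A φ (∫ x, φ x ∂(μ₀ : Measure (ℕ → Fin N))) by linarith)
  obtain ⟨z, hz, p, hp, hzp, hzB⟩ := exists_periodic_integral_lt hS htrans hBu hBm hμ
    (show 0 < ε / 4 by linarith)
  obtain ⟨w, hw, q, hq, hwq, hne⟩ : ∃ w ∈ S, ∃ q : ℕ, 0 < q ∧ Shift^[q] w = w ∧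
      birkhoff q φ w / q ≠ birkhoff p φ z / p := by
    by_contra! hall
    refine hφnc (hφlc.cohomologousToConstant hS htrans (a := birkhoff p φ z / p) ?_)
    intro w hw q hq hwq
    rw [← hall w hw q hq hwq, mul_div_cancel₀]
    exact_mod_cast hq.ne'
  obtain ⟨u, hu, T, hT, huT, hmem, huB⟩ := exists_periodic_between hS htrans hφu hBu hz hw hp hq
    hzp hwq hne (show 0 < ε / 4 by linarith)
  obtain ⟨ρ, hρ, hρper, hρint⟩ := exists_periodicMeasure hS hu hT huT
  refine ⟨birkhoff T φ u / T, ?_, ?_, ρ, hρ, hρper, hρint φ, ?_⟩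
  · choose g hg using hφQ
    refine ⟨(∑ j ∈ Finset.range T, g (Shift^[j] u)) / T, ?_⟩
    push_cast
    simp only [birkhoff, hg]
  · have hmemrot : ∀ v ∈ S, ∀ k : ℕ, 0 < k → Shift^[k] v = v →
        birkhoff k φ v / k ∈ rotSet1 S φ := by
      intro v hv k hk hvk
      obtain ⟨ν, hν, -, hνint⟩ := exists_periodicMeasure hS hv hk hvk
      exact ⟨ν, hν, hνint φ⟩
    refine mem_interior.2 ⟨_, Ioo_subset_Icc_self.trans ?_, isOpen_Ioo, hmem⟩
    exact (rotSet1_ordConnected hS hφu hφm).uIcc_subset (hmemrot z hz p hp hzp)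
      (hmemrot w hw q hq hwq)
  · have h1 := hBint ρ hρ
    rw [hρint, hρint φ] at h1
    have h2 := hBint μ hμ
    rw [hμφ] at h2
    linarith
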